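/- Garsia–Lamperti oscillatory integral estimate: let β ∈ (1/2,1), let ℓ be slowly varying, let E be a complex Banach space, and let T : (0,π] → B(E) be a norm-continuous family of bounded operators such that for some K > 0: (i) ‖T(θ)‖ ≤ K ℓ(1/θ)^{−1} θ^{−β} for all θ ∈ (0,π], and (ii) ‖T(θ) − T(θ′)‖ ≤ K ‖T(θ)‖·‖T(θ′)‖·ℓ(1/(θ−θ′))·(θ−θ′)^β for all 0 < θ′ < θ ≤ π. Then for every β′ ∈ (0,β) there is a constant C > 0 such that ‖ ∫_{a/n}^{π} T(θ) e^{−inθ} dθ ‖ ≤ C ℓ(n)^{−1} n^{−(1−β)} a^{−(2β′−1)} for all n ≥ 1 and all real a ∈ [1, n]. -/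

import Mathlib

open MeasureTheory Filter Topology

/-- `l` is slowly varying: measurable, bounded above and below by positive constants on
each compact subset of `(0,∞)`, and `l (λ x)/ l x → 1` as `x → ∞` for every `λ > 0`. -/
def SlowlyVarying (l : ℝ → ℝ) : Prop :=
  Measurable l ∧
  (∀ K : Set ℝ, IsCompact K → K ⊆ Set.Ioi 0 →
    ∃ c C : ℝ, 0 < c ∧ ∀ x ∈ K, c ≤ l x ∧ l x ≤ C) ∧
  ∀ lam : ℝ, 0 < lam → Tendsto (fun x => l (lam * x) / l x) atTop (𝓝 1)

lemma aux_unif (h : ℝ → ℝ) (hm : Measurable h)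
    (hh : ∀ t : ℝ, Tendsto (fun x => h (x + t) - h x) atTop (𝓝 0)) :
    ∃ X : ℝ, ∀ x ≥ X, ∀ t ∈ Set.Icc (0:ℝ) 1, |h (x + t) - h x| ≤ 1 := by
  let B : ℝ → Set ℝ := fun x => {s | 1/2 < |h (x + s) - h x|}
  have hBm : ∀ x, MeasurableSet (B x) := by
    intro x
    exact measurableSet_lt measurable_const (by fun_prop)
  have hlim : Tendsto (fun x => ∫⁻ s in Set.Icc (0:ℝ) 2, (B x).indicator (fun _ => (1:ENNReal)) s) atTop
      (𝓝 (∫⁻ s in Set.Icc (0:ℝ) 2, 0)) := by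
    apply tendsto_lintegral_filter_of_dominated_convergence (fun _ => 1)
    · exact Eventually.of_forall fun x => measurable_const.indicator (hBm x)
    · refine Eventually.of_forall fun x => Eventually.of_forall fun s => ?_
      exact Set.indicator_le_self' (by simp) s
    · simp
    · refine Eventually.of_forall fun s => ?_
      apply tendsto_const_nhds.congr'
      have := (hh s).abs
      rw [abs_zero] at this
      filter_upwards [this.eventually (gt_mem_nhds (show (0:ℝ) < 1/2 by norm_num))] with x hx
      rw [Set.indicator_of_notMem]
      simp only [B, Set.mem_ofPred_eq, not_lt]
      exact hx.le
  have hF : ∀ x, ∫⁻ s in Set.Icc (0:ℝ) 2, (B x).indicator (fun _ => (1:ENNReal)) s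
      = volume (B x ∩ Set.Icc 0 2) := by
    intro x
    rw [lintegral_indicator (hBm x)]
    simp [Measure.restrict_apply, hBm x]
  simp only [hF, lintegral_zero] at hlim
  have hev := hlim.eventually (gt_mem_nhds (show (0:ENNReal) < 1/2 by simp))
  obtain ⟨X, hX⟩ := eventually_atTop.1 hev
  refine ⟨X, fun x hx t ht => ?_⟩
  by_contra hcon
  push Not at hcon
  have h1 := hX x hx
  have h2 := hX (x + t) (by linarith [ht.1])
  have hsub : Set.Icc (1:ℝ) 2 ⊆ (B x ∩ Set.Icc 0 2) ∪ ((fun r => r + (-t)) ⁻¹' (B (x + t) ∩ Set.Icc 0 2)) := by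
    intro r hr
    by_cases hb : r ∈ B x
    · exact Or.inl ⟨hb, by constructor <;> linarith [hr.1, hr.2]⟩
    · right
      refine ⟨?_, by constructor <;> linarith [hr.1, hr.2, ht.1, ht.2]⟩
      simp only [B, Set.mem_ofPred_eq, not_lt] at hb ⊢
      have e : x + t + (r + -t) = x + r := by ring
      rw [e]
      have := abs_sub_le (h (x+t)) (h (x + r)) (h x)
      rw [abs_sub_comm (h (x+t)) (h (x+r))] at this
      linarith
  have h3 := (measure_mono hsub).trans (measure_union_le (μ := volume) _ _)
  rw [measure_preimage_add_right] at h3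
  have h4 := h3.trans_lt (ENNReal.add_lt_add h1 h2)
  rw [ENNReal.add_halves] at h4
  norm_num at h4

lemma aux_potter_log (h : ℝ → ℝ) (hm : Measurable h)
    (hh : ∀ t : ℝ, Tendsto (fun x => h (x + t) - h x) atTop (𝓝 0)) (δ : ℝ) (hδ : 0 < δ) :
    ∃ X : ℝ, ∀ x ≥ X, ∀ t ≥ (0:ℝ), h (x + t) - h x ≤ δ * t + 1 := by
  obtain ⟨X, hX⟩ := aux_unif h hm hh
  obtain ⟨Y, hY⟩ := eventually_atTop.1 ((hh 1).eventually (gt_mem_nhds hδ))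
  have key : ∀ k : ℕ, ∀ x ≥ Y, h (x + k) - h x ≤ δ * k := by
    intro k
    induction k with
    | zero => intro x hx; simp
    | succ k ih =>
      intro x hx
      have h1 := ih x hx
      have h2 := hY (x + k) (by have : (0:ℝ) ≤ k := by positivity
                                linarith)
      push_cast
      rw [← add_assoc]
      linarith
  refine ⟨max X Y, fun x hx t ht => ?_⟩
  have h1 := key ⌊t⌋₊ x (le_trans (le_max_right _ _) hx)
  have hk : (0:ℝ) ≤ ⌊t⌋₊ := by positivity
  have hf := Nat.floor_le ht
  have hf2 := Nat.lt_floor_add_one t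
  have h2 := hX (x + ⌊t⌋₊) (by linarith [le_max_left X Y]) (t - ⌊t⌋₊) ⟨by linarith, by linarith⟩
  rw [show x + ⌊t⌋₊ + (t - ⌊t⌋₊) = x + t by ring] at h2
  have := (abs_le.1 h2).2
  nlinarith

lemma aux_pos {l : ℝ → ℝ} (hl : SlowlyVarying l) {x : ℝ} (hx : 0 < x) : 0 < l x := by
  obtain ⟨c, C, hc, h⟩ := hl.2.1 {x} isCompact_singleton (by simpa using hx)
  exact hc.trans_le (h x rfl).1

lemma aux_potter {l : ℝ → ℝ} (hl : SlowlyVarying l) (δ : ℝ) (hδ : 0 < δ) (c₀ : ℝ) (hc₀ : 0 < c₀) :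
    ∃ C : ℝ, 0 < C ∧ ∀ y ≥ c₀, ∀ u ≥ (1:ℝ), l (u * y) ≤ C * u ^ δ * l y := by
  obtain ⟨X, hX⟩ := aux_potter_log (fun x => Real.log (l (Real.exp x)))
    (Real.measurable_log.comp (hl.1.comp Real.measurable_exp)) (by
      intro t
      have h1 := (hl.2.2 (Real.exp t) (Real.exp_pos t)).comp Real.tendsto_exp_atTop
      have h2 := (Real.continuousAt_log one_ne_zero).tendsto.comp h1
      rw [Real.log_one] at h2
      refine h2.congr fun x => ?_
      simp only [Function.comp]
      rw [Real.log_div (aux_pos hl (by positivity)).ne' (aux_pos hl (by positivity)).ne',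
        Real.exp_add, mul_comm (Real.exp t)]) δ hδ
  set Y := max (Real.exp X) c₀ with hY
  have hYpos : 0 < Y := hc₀.trans_le (le_max_right _ _)
  have hbig : ∀ y ≥ Y, ∀ u ≥ (1:ℝ), l (u * y) ≤ Real.exp 1 * u ^ δ * l y := by
    intro y hy u hu
    have hy0 : 0 < y := hYpos.trans_le hy
    have hu0 : 0 < u := by linarith
    have h := hX (Real.log y) ((Real.le_log_iff_exp_le hy0).2 ((le_max_left _ _).trans hy))
      (Real.log u) (Real.log_nonneg hu)
    simp only [Real.exp_add, Real.exp_log hy0, Real.exp_log hu0] at h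
    have p1 := aux_pos hl (mul_pos hy0 hu0)
    have p2 := aux_pos hl hy0
    rw [mul_comm u y, ← Real.exp_log p1, ← Real.exp_log p2, Real.rpow_def_of_pos hu0,
      ← Real.exp_add, ← Real.exp_add]
    apply Real.exp_le_exp.2
    linarith
  obtain ⟨c, D, hc, hD⟩ := hl.2.1 (Set.Icc c₀ Y) isCompact_Icc (fun x hx => hc₀.trans_le hx.1)
  have hcD : c ≤ D := (hD Y ⟨le_max_right _ _, le_rfl⟩).1.trans (hD Y ⟨le_max_right _ _, le_rfl⟩).2
  have hD0 : 0 < D := hc.trans_le hcD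
  have hDc : 1 ≤ D / c := (one_le_div hc).2 hcD
  have he : 1 ≤ Real.exp 1 := Real.one_le_exp (by norm_num)
  refine ⟨Real.exp 1 * (D / c), by positivity, fun y hy u hu => ?_⟩
  have hy0 : 0 < y := hc₀.trans_le hy
  have hu0 : 0 < u := by linarith
  have p2 := aux_pos hl hy0
  have hud : 1 ≤ u ^ δ := Real.one_le_rpow hu hδ.le
  rcases le_total Y y with hYy | hyY
  · refine (hbig y hYy u hu).trans ?_
    gcongr
    nlinarith
  · have h1 := hD y ⟨hy, hyY⟩
    have h3 : D ≤ D / c * l y := by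
      rw [div_mul_eq_mul_div, le_div_iff₀ hc]; nlinarith
    rcases le_total (u * y) Y with h2 | h2
    · have := (hD (u * y) ⟨by nlinarith, h2⟩).2
      calc l (u * y) ≤ D / c * l y := this.trans h3
        _ = 1 * (D / c) * 1 * l y := by ring
        _ ≤ _ := by gcongr
    · have h4 := hbig Y le_rfl (u * y / Y) ((one_le_div hYpos).2 h2)
      rw [div_mul_cancel₀ _ hYpos.ne'] at h4
      refine h4.trans ?_
      have h5 : u * y / Y ≤ u := by rw [div_le_iff₀ hYpos]; gcongr
      have h6 := (hD Y ⟨le_max_right _ _, le_rfl⟩).2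
      have h7 := aux_pos hl hYpos
      calc _ ≤ Real.exp 1 * u ^ δ * (D / c * l y) := by
            gcongr; exact h6.trans h3
        _ = _ := by ring

lemma aux_scale {l : ℝ → ℝ} (hl : SlowlyVarying l) (s : ℝ) (hs : 0 < s) :
    ∃ C : ℝ, 0 < C ∧ ∀ x ≥ (1:ℝ), l (s * x) ≤ C * l x := by
  obtain ⟨X, hX⟩ := eventually_atTop.1 ((hl.2.2 s hs).eventually (gt_mem_nhds one_lt_two))
  obtain ⟨c, _, hc, h1⟩ := hl.2.1 (Set.Icc 1 (max X 1)) isCompact_Icc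
    (fun x hx => zero_lt_one.trans_le hx.1)
  obtain ⟨_, D, _, h2⟩ := hl.2.1 (Set.Icc s (s * max X 1)) isCompact_Icc
    (fun x hx => hs.trans_le hx.1)
  have hD : 0 < D := (aux_pos hl hs).trans_le
    (h2 s ⟨le_rfl, by nlinarith [le_max_right X 1]⟩).2
  refine ⟨max 2 (D / c), by positivity, fun x hx => ?_⟩
  have p := aux_pos hl (zero_lt_one.trans_le hx)
  rcases le_total X x with h | h
  · have := (hX x h).le
    rw [div_le_iff₀ p] at this
    exact this.trans (by gcongr; exact le_max_left _ _)
  · have hxm : x ≤ max X 1 := h.trans (le_max_left _ _)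
    have a1 := (h1 x ⟨hx, hxm⟩).1
    have a2 := (h2 (s * x) ⟨by nlinarith, by gcongr⟩).2
    calc l (s * x) ≤ D := a2
      _ ≤ D / c * l x := by rw [div_mul_eq_mul_div, le_div_iff₀ hc]; nlinarith
      _ ≤ _ := by gcongr; exact le_max_right _ _

lemma aux_osc {E : Type*} [NormedAddCommGroup E] [NormedSpace ℂ E] [CompleteSpace E]
    (T : ℝ → E →L[ℂ] E) (hTcont : ContinuousOn T (Set.Ioc 0 Real.pi))
    (n : ℕ) (hn : 1 ≤ n) (b M L γ h : ℝ) (hh : h = Real.pi / n) (hb : 0 < b) (hbpi : b ≤ Real.pi)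
    (hM : 0 ≤ M) (hL : 0 ≤ L) (hγ : 1 / 2 < γ)
    (h1 : ∀ θ, b ≤ θ → θ ≤ Real.pi → ‖T θ‖ ≤ M * θ ^ (-γ))
    (h2 : ∀ θ, b + h ≤ θ → θ ≤ Real.pi → ‖T θ - T (θ - h)‖ ≤ L * ‖T θ‖ * ‖T (θ - h)‖) :
    ‖∫ θ in b..Real.pi, Complex.exp (-(Complex.I * n * θ)) • T θ‖ ≤
      2 * (h * M * b ^ (-γ)) + L * M ^ 2 * (b ^ (1 - 2 * γ) / (2 * γ - 1)) := by
  have hn0 : (0:ℝ) < n := by exact_mod_cast hn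
  have hh0 : 0 < h := by rw [hh]; positivity
  set e : ℝ → ℂ := fun θ => Complex.exp (-(Complex.I * n * θ)) with he
  have hecont : Continuous e := by fun_prop
  have hnorm : ∀ θ, ‖e θ‖ = 1 := by
    intro θ
    simp only [he]
    rw [show -(Complex.I * n * θ) = ((-(n * θ) : ℝ) : ℂ) * Complex.I by push_cast; ring]
    exact Complex.norm_exp_ofReal_mul_I _
  have hshift : ∀ θ, e (θ - h) = - e θ := by
    intro θ
    simp only [he]
    have hnC : (n:ℂ) ≠ 0 := by exact_mod_cast hn0.ne'
    rw [show -(Complex.I * n * ((θ - h : ℝ) : ℂ)) = -(Complex.I * n * θ) + Real.pi * Complex.I by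
      rw [hh]; push_cast; field_simp; ring]
    rw [Complex.exp_add, Complex.exp_pi_mul_I]; ring
  have hsb : ∀ p q, b ≤ p → p ≤ q → q ≤ Real.pi → q - p ≤ h →
      ‖∫ θ in p..q, e θ • T θ‖ ≤ h * M * b ^ (-γ) := by
    intro p q hp hpq hq hqp
    have : ‖∫ θ in p..q, e θ • T θ‖ ≤ (M * b ^ (-γ)) * |q - p| := by
      apply intervalIntegral.norm_integral_le_of_norm_le_const
      intro x hx
      rw [Set.uIoc_of_le hpq] at hx
      rw [norm_smul, hnorm, one_mul]
      refine (h1 x (by linarith [hx.1]) (by linarith [hx.2])).trans ?_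
      gcongr M * ?_
      exact Real.rpow_le_rpow_of_nonpos hb (by linarith [hx.1]) (by linarith)
    rw [abs_of_nonneg (by linarith)] at this
    refine this.trans ?_
    calc M * b ^ (-γ) * (q - p) ≤ M * b ^ (-γ) * h := by gcongr
      _ = _ := by ring
  have hP : 0 ≤ h * M * b ^ (-γ) := by positivity
  have hQ : 0 ≤ L * M ^ 2 * (b ^ (1 - 2 * γ) / (2 * γ - 1)) := by
    have : 0 < 2 * γ - 1 := by linarith
    positivity
  rcases le_total Real.pi (b + h) with hc | hc
  · have := hsb b Real.pi le_rfl hbpi le_rfl (by linarith)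
    linarith
  have hTc : ∀ p q, b ≤ p → p ≤ q → q ≤ Real.pi → ContinuousOn (fun θ => e θ • T θ) (Set.uIcc p q) := by
    intro p q hp hpq hq
    rw [Set.uIcc_of_le hpq]
    exact hecont.continuousOn.smul (hTcont.mono fun x hx => ⟨by linarith [hx.1], by linarith [hx.2]⟩)
  have hint : ∀ p q, b ≤ p → p ≤ q → q ≤ Real.pi →
      IntervalIntegrable (fun θ => e θ • T θ) volume p q :=
    fun p q hp hpq hq => (hTc p q hp hpq hq).intervalIntegrable
  have e1 := intervalIntegral.integral_add_adjacent_intervals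
    (hint b (b + h) le_rfl (by linarith) hc) (hint (b + h) Real.pi (by linarith) hc le_rfl)
  have e2 := intervalIntegral.integral_add_adjacent_intervals
    (hint b (Real.pi - h) le_rfl (by linarith) (by linarith))
    (hint (Real.pi - h) Real.pi (by linarith) (by linarith) le_rfl)
  have hs := intervalIntegral.integral_comp_sub_right (a := b + h) (b := Real.pi)
    (fun θ => e θ • T θ) h
  rw [add_sub_cancel_right] at hs
  have hint2 : IntervalIntegrable (fun θ => e (θ - h) • T (θ - h)) volume (b + h) Real.pi := by
    apply ContinuousOn.intervalIntegrable
    refine (hTc b (Real.pi - h) le_rfl (by linarith) (by linarith)).comp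
      (f := fun θ => θ - h) (by fun_prop) ?_
    intro x hx
    rw [Set.uIcc_of_le hc] at hx
    rw [Set.uIcc_of_le (by linarith)]
    exact ⟨by linarith [hx.1], by linarith [hx.2]⟩
  have e3 := intervalIntegral.integral_add (hint (b + h) Real.pi (by linarith) hc le_rfl) hint2
  have hbound : ‖∫ θ in (b + h)..Real.pi, (e θ • T θ + e (θ - h) • T (θ - h))‖ ≤
      L * M ^ 2 * (b ^ (1 - 2 * γ) / (2 * γ - 1)) := by
    have hz : (0:ℝ) ∉ Set.uIcc b (Real.pi - h) := by
      rw [Set.uIcc_of_le (by linarith)]; intro hx; linarith [hx.1]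
    have hgi : IntervalIntegrable (fun θ => L * M ^ 2 * (θ - h) ^ (-(2 * γ))) volume
        (b + h) Real.pi := by
      apply ContinuousOn.intervalIntegrable
      apply ContinuousOn.mul continuousOn_const
      apply ContinuousOn.rpow_const (by fun_prop)
      intro x hx
      rw [Set.uIcc_of_le hc] at hx
      left; linarith [hx.1]
    refine (intervalIntegral.norm_integral_le_of_norm_le hc (Eventually.of_forall ?_) hgi).trans ?_
    · intro x hx
      have hx0 : 0 < x - h := by linarith [hx.1]
      rw [hshift, neg_smul, ← sub_eq_add_neg, ← smul_sub, norm_smul, hnorm, one_mul]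
      have a1 : ‖T x‖ ≤ M * (x - h) ^ (-γ) := by
        refine (h1 x (by linarith [hx.1]) hx.2).trans ?_
        gcongr M * ?_
        exact Real.rpow_le_rpow_of_nonpos hx0 (by linarith) (by linarith)
      have a2 := h1 (x - h) (by linarith [hx.1]) (by linarith [hx.2])
      calc _ ≤ L * ‖T x‖ * ‖T (x - h)‖ := h2 x hx.1.le hx.2
        _ ≤ L * (M * (x - h) ^ (-γ)) * (M * (x - h) ^ (-γ)) := by gcongr
        _ = L * M ^ 2 * ((x - h) ^ (-γ) * (x - h) ^ (-γ)) := by ring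
        _ = _ := by rw [← Real.rpow_add hx0]; ring_nf
    · rw [intervalIntegral.integral_const_mul]
      gcongr L * M ^ 2 * ?_
      rw [intervalIntegral.integral_comp_sub_right (fun x => x ^ (-(2 * γ))), add_sub_cancel_right,
        integral_rpow (Or.inr ⟨by linarith, hz⟩)]
      have hp : 0 ≤ (Real.pi - h) ^ (1 - 2 * γ) := Real.rpow_nonneg (by linarith) _
      have hg : 0 < 2 * γ - 1 := by linarith
      rw [show -(2 * γ) + 1 = 1 - 2 * γ by ring, show 1 - 2 * γ = -(2 * γ - 1) by ring, div_neg,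
        ← neg_div]
      rw [show 1 - 2 * γ = -(2 * γ - 1) by ring] at hp
      gcongr
      linarith
  have b1 := hsb b (b + h) le_rfl (by linarith) hc (by linarith)
  have b2 := hsb (Real.pi - h) Real.pi (by linarith) (by linarith) le_rfl (by linarith)
  have e4 : (2:ℝ) • (∫ θ in b..Real.pi, e θ • T θ) = (∫ θ in b..(b + h), e θ • T θ)
      + (∫ θ in (Real.pi - h)..Real.pi, e θ • T θ)
      + ∫ θ in (b + h)..Real.pi, (e θ • T θ + e (θ - h) • T (θ - h)) := by
    rw [e3, hs, two_smul]
    nth_rewrite 1 [← e1]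
    rw [← e2]
    abel
  have e5 := congrArg norm e4
  rw [norm_smul] at e5
  have e6 := e5.le.trans (norm_add₃_le)
  norm_num at e6
  have := norm_nonneg (∫ θ in b..Real.pi, e θ • T θ)
  linarith

theorem garsia_lamperti_oscillatory_estimate
    (β : ℝ) (hβ1 : 1 / 2 < β) (hβ2 : β < 1)
    (l : ℝ → ℝ) (hl : SlowlyVarying l)
    {E : Type*} [NormedAddCommGroup E] [NormedSpace ℂ E] [CompleteSpace E]
    (T : ℝ → E →L[ℂ] E) (hTcont : ContinuousOn T (Set.Ioc 0 Real.pi))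
    (K : ℝ) (hK : 0 < K)
    (hT1 : ∀ θ ∈ Set.Ioc (0 : ℝ) Real.pi, ‖T θ‖ ≤ K * (l (1 / θ))⁻¹ * θ ^ (-β))
    (hT2 : ∀ θ θ' : ℝ, 0 < θ' → θ' < θ → θ ≤ Real.pi →
      ‖T θ - T θ'‖ ≤ K * ‖T θ‖ * ‖T θ'‖ * l (1 / (θ - θ')) * (θ - θ') ^ β) :
    ∀ β' : ℝ, 0 < β' → β' < β → ∃ C : ℝ, 0 < C ∧
      ∀ n : ℕ, 1 ≤ n → ∀ a : ℝ, 1 ≤ a → a ≤ n →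
        ‖∫ θ in (a / n : ℝ)..Real.pi, Complex.exp (-(Complex.I * n * θ)) • T θ‖
          ≤ C * (l n)⁻¹ * (n : ℝ) ^ (-(1 - β)) * a ^ (-(2 * β' - 1)) := by
  intro β' hβ'0 hβ'
  have hpi := Real.pi_pos
  set γ := max β' ((β + 1 / 2) / 2) with hγ
  have hγ1 : 1 / 2 < γ := lt_of_lt_of_le (by linarith) (le_max_right _ _)
  have hγ2 : γ < β := max_lt hβ' (by linarith)
  have hγ3 : β' ≤ γ := le_max_left _ _
  obtain ⟨C, hC, hpot⟩ := aux_potter hl (β - γ) (by linarith) (1 / Real.pi) (by positivity)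
  obtain ⟨D, hD, hsc⟩ := aux_scale hl (1 / Real.pi) (by positivity)
  have hg : 0 < 2 * γ - 1 := by linarith
  refine ⟨2 * (Real.pi * (K * C)) + K * D * Real.pi ^ β * (K * C) ^ 2 / (2 * γ - 1),
    by positivity, fun n hn a ha han => ?_⟩
  have hn1 : (1:ℝ) ≤ n := by exact_mod_cast hn
  have hn0 : (0:ℝ) < n := by linarith
  have ha0 : 0 < a := by linarith
  have hln : 0 < l n := aux_pos hl hn0
  have hh0 : 0 < Real.pi / n := by positivity
  have hb0 : 0 < a / n := by positivity
  have hb1 : a / n ≤ Real.pi := by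
    have : a / n ≤ 1 := (div_le_one hn0).2 han
    linarith [Real.pi_gt_three]
  have hlh : l (1 / (Real.pi / n)) ≤ D * l n := by
    rw [show 1 / (Real.pi / n) = 1 / Real.pi * n by field_simp]
    exact hsc n hn1
  have main := aux_osc T hTcont n hn (a / n) (K * C * n ^ (β - γ) * (l n)⁻¹)
    (K * (D * l n) * (Real.pi / n) ^ β) γ (Real.pi / n) rfl hb0 hb1 (by positivity) (by positivity)
    hγ1 (by
      intro θ hθ1 hθ2
      have hθ0 : 0 < θ := by linarith
      refine (hT1 θ ⟨hθ0, hθ2⟩).trans ?_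
      have hu : 1 ≤ n * θ := by
        rw [div_le_iff₀ hn0] at hθ1; linarith
      have hp := hpot (1 / θ) (one_div_le_one_div_of_le hθ0 hθ2) (n * θ) hu
      rw [show n * θ * (1 / θ) = n by field_simp] at hp
      have hlp : 0 < l (1 / θ) := aux_pos hl (by positivity)
      have hinv : (l (1 / θ))⁻¹ ≤ C * (n * θ) ^ (β - γ) * (l n)⁻¹ := by
        rw [← div_eq_mul_inv, le_div_iff₀ hln, inv_mul_le_iff₀ hlp]
        linarith
      calc _ ≤ K * (C * (n * θ) ^ (β - γ) * (l n)⁻¹) * θ ^ (-β) := by gcongr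
        _ = K * C * n ^ (β - γ) * (l n)⁻¹ * (θ ^ (β - γ) * θ ^ (-β)) := by
          rw [Real.mul_rpow hn0.le hθ0.le]; ring
        _ = _ := by rw [← Real.rpow_add hθ0]; ring_nf) (by
      intro θ hθ1 hθ2
      have := hT2 θ (θ - Real.pi / n) (by linarith) (by linarith) hθ2
      rw [sub_sub_cancel] at this
      refine this.trans ?_
      calc _ ≤ K * ‖T θ‖ * ‖T (θ - Real.pi / n)‖ * (D * l n) * (Real.pi / n) ^ β := by gcongr
        _ = _ := by ring)
  refine main.trans ?_
  have hx1 : a ^ (-γ) ≤ a ^ (-(2 * β' - 1)) := Real.rpow_le_rpow_of_exponent_le ha (by linarith)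
  have hx2 : a ^ (1 - 2 * γ) ≤ a ^ (-(2 * β' - 1)) :=
    Real.rpow_le_rpow_of_exponent_le ha (by linarith)
  have t1 : Real.pi / n * (K * C * n ^ (β - γ) * (l n)⁻¹) * (a / n) ^ (-γ)
      = Real.pi * (K * C) * (l n)⁻¹ * (n:ℝ) ^ (-(1 - β)) * a ^ (-γ) := by
    have : (n:ℝ) ^ (-(1 - β)) = (n:ℝ)⁻¹ * n ^ (β - γ) * n ^ γ := by
      rw [← Real.rpow_neg_one, ← Real.rpow_add hn0, ← Real.rpow_add hn0]; ring_nf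
    rw [this, Real.div_rpow ha0.le hn0.le, Real.rpow_neg hn0.le, div_inv_eq_mul]
    ring
  have t2 : K * (D * l n) * (Real.pi / n) ^ β * (K * C * n ^ (β - γ) * (l n)⁻¹) ^ 2
        * ((a / n) ^ (1 - 2 * γ) / (2 * γ - 1))
      = K * D * Real.pi ^ β * (K * C) ^ 2 / (2 * γ - 1) * (l n)⁻¹ * (n:ℝ) ^ (-(1 - β))
        * a ^ (1 - 2 * γ) := by
    have : (n:ℝ) ^ (-(1 - β)) = ((n:ℝ) ^ β)⁻¹ * ((n:ℝ) ^ (β - γ)) ^ 2 * ((n:ℝ) ^ (1 - 2 * γ))⁻¹ := by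
      rw [← Real.rpow_neg hn0.le, ← Real.rpow_neg hn0.le, sq, ← Real.rpow_add hn0,
        ← Real.rpow_add hn0, ← Real.rpow_add hn0]; ring_nf
    rw [this, Real.div_rpow ha0.le hn0.le, Real.div_rpow hpi.le hn0.le]
    field_simp
  rw [t1, t2]
  calc _ ≤ 2 * (Real.pi * (K * C) * (l n)⁻¹ * (n:ℝ) ^ (-(1 - β)) * a ^ (-(2 * β' - 1)))
      + K * D * Real.pi ^ β * (K * C) ^ 2 / (2 * γ - 1) * (l n)⁻¹ * (n:ℝ) ^ (-(1 - β))
        * a ^ (-(2 * β' - 1)) := by gcongr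
    _ = _ := by ring
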